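/- arXiv:1511.07305 — 2 statements merged into one kernel-verified Lean document; each statement's English description precedes it below -/
import Mathlib

section
/- Theorem (recovery of dynamic communicability, first part): let A^[1],…,A^[M] be real n×n matrices and a > 0 with a·ρ(A^[s]) < 1 for all s. Let B be the Mn×Mn block matrix with (k,k) block aA^[k], (k,k+1) block I_n, and zero elsewhere. Then I_{Mn} − B is invertible and, for all 1 ≤ i ≤ j ≤ M, the (i,j) block of (I_{Mn} − B)^{-1} equals the dynamic communicability matrix Q^{[i,j]} = ∏_{s=i}^{j} (I − aA^[s])^{-1}. -/
open Matrix BigOperators Finset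

/-- Spectral radius of a real square matrix: the `ℝ≥0∞`-valued spectral radius of its
complexification, i.e. the maximum modulus of its complex eigenvalues. -/
noncomputable def specRad {ι : Type*} [Fintype ι] [DecidableEq ι]
    (A : Matrix ι ι ℝ) : ENNReal :=
  spectralRadius ℂ (A.map (algebraMap ℝ ℂ))

/-- The ordered product `∏_{s=i}^{j} (I - a A^[s])⁻¹`, factors in increasing order of `s`
(the dynamic communicability matrix `Q^{[i,j]}`). -/
noncomputable def resProd {n : ℕ} (a : ℝ) (A : ℕ → Matrix (Fin n) (Fin n) ℝ) (i j : ℕ) :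
    Matrix (Fin n) (Fin n) ℝ :=
  ((List.range (j + 1 - i)).map (fun t => (1 - a • A (i + t))⁻¹)).prod

/-- The `Mn × Mn` block bidiagonal matrix with diagonal blocks `α A^[k]` (`k = 1,…,M`,
block `k` of `Fin M` corresponding to time index `k+1`), superdiagonal blocks
`β_{k+1} I_n`, and zero blocks elsewhere. -/
noncomputable def blockB {n : ℕ} (M : ℕ) (α : ℝ) (β : ℕ → ℝ)
    (A : ℕ → Matrix (Fin n) (Fin n) ℝ) :
    Matrix (Fin M × Fin n) (Fin M × Fin n) ℝ :=
  fun p q =>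
    if p.1 = q.1 then α * A (p.1.1 + 1) p.2 q.2
    else if p.1.1 + 1 = q.1.1 then (if p.2 = q.2 then β (q.1.1 + 1) else 0)
    else 0

/-- The `(i,j)` block (1-based block indices `1 ≤ i, j ≤ M`) of an `Mn × Mn` matrix. -/
noncomputable def blockOf {n M : ℕ} (C : Matrix (Fin M × Fin n) (Fin M × Fin n) ℝ)
    (i j : ℕ) : Matrix (Fin n) (Fin n) ℝ :=
  fun x y => if h : i - 1 < M ∧ j - 1 < M then C (⟨i - 1, h.1⟩, x) (⟨j - 1, h.2⟩, y) else 0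

/-- If `a > 0` and `a ρ(A) < 1`, then `I - a A` is invertible. -/
theorem isUnit_one_sub_smul_of_specRad_lt {ι : Type*} [Fintype ι] [DecidableEq ι]
    (A : Matrix ι ι ℝ) {a : ℝ} (ha : 0 < a) (h : ENNReal.ofReal a * specRad A < 1) :
    IsUnit (1 - a • A) := by
  have hlt : spectralRadius ℂ (A.map (algebraMap ℝ ℂ)) < ‖((a : ℂ)⁻¹)‖₊ := by
    have hnorm : ((‖((a : ℂ)⁻¹)‖₊ : NNReal) : ENNReal) = (ENNReal.ofReal a)⁻¹ := by
      rw [← enorm_eq_nnnorm, ← Complex.ofReal_inv, ← ofReal_norm, Complex.norm_real,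
        Real.norm_of_nonneg (inv_nonneg.mpr ha.le), ENNReal.ofReal_inv_of_pos ha]
    rw [hnorm, ← one_div, ENNReal.lt_div_iff_mul_lt (by simp [ha]) (by simp), mul_comm]
    exact h
  have hres := spectrum.mem_resolventSet_of_spectralRadius_lt hlt
  rw [spectrum.mem_resolventSet_iff] at hres
  have hac : (a : ℂ) ≠ 0 := by exact_mod_cast ha.ne'
  have hmap : (1 - a • A).map (algebraMap ℝ ℂ) =
      (a : ℂ) • (algebraMap ℂ (Matrix ι ι ℂ) (a : ℂ)⁻¹ - A.map (algebraMap ℝ ℂ)) := by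
    ext i j
    by_cases hij : i = j <;>
      simp [hij, Matrix.algebraMap_matrix_apply, mul_sub, hac]
  rw [Matrix.isUnit_iff_isUnit_det, isUnit_iff_ne_zero] at hres ⊢
  intro h0
  have hdet : ((1 - a • A).map (algebraMap ℝ ℂ)).det = 0 := by
    rw [← RingHom.mapMatrix_apply, ← RingHom.map_det, h0, map_zero]
  rw [hmap, Matrix.det_smul] at hdet
  exact (mul_ne_zero (pow_ne_zero _ hac) hres) hdet

theorem resProd_self {n : ℕ} (a : ℝ) (A : ℕ → Matrix (Fin n) (Fin n) ℝ) (i : ℕ) :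
    resProd a A i i = (1 - a • A i)⁻¹ := by
  simp [resProd]

theorem resProd_eq_mul {n : ℕ} (a : ℝ) (A : ℕ → Matrix (Fin n) (Fin n) ℝ) {i j : ℕ}
    (hij : i ≤ j) :
    resProd a A i j = (1 - a • A i)⁻¹ * resProd a A (i + 1) j := by
  have hlen : j + 1 - i = (j + 1 - (i + 1)) + 1 := by omega
  simp only [resProd]
  rw [hlen, List.range_succ_eq_map]
  simp [Function.comp_def, add_comm, add_left_comm]

/-- The block upper triangular matrix whose `(k,l)` block, `k ≤ l`, is the communicability
matrix of the corresponding window. -/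
noncomputable def communicabilityBlocks {n : ℕ} (M : ℕ) (a : ℝ)
    (A : ℕ → Matrix (Fin n) (Fin n) ℝ) :
    Matrix (Fin M) (Fin M) (Matrix (Fin n) (Fin n) ℝ) :=
  fun k l => if k ≤ l then resProd a A (k + 1) (l + 1) else 0

/-- `I - B` as a matrix of blocks. -/
noncomputable def oneSubBlocks {n : ℕ} (M : ℕ) (a : ℝ)
    (A : ℕ → Matrix (Fin n) (Fin n) ℝ) :
    Matrix (Fin M) (Fin M) (Matrix (Fin n) (Fin n) ℝ) :=
  fun k l => (if k = l then 1 - a • A (k + 1) else 0) - if (k : ℕ) + 1 = l then 1 else 0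

theorem comp_oneSubBlocks {n : ℕ} (M : ℕ) (a : ℝ) (A : ℕ → Matrix (Fin n) (Fin n) ℝ) :
    Matrix.comp _ _ _ _ _ (oneSubBlocks M a A) = 1 - blockB M a (fun _ => 1) A := by
  ext ⟨k, x⟩ ⟨l, y⟩
  by_cases hkl : k = l
  · subst hkl
    simp [oneSubBlocks, blockB, Matrix.one_apply]
  · by_cases hs : (k : ℕ) + 1 = l <;>
      simp [oneSubBlocks, blockB, Matrix.one_apply, hkl, hs]

theorem oneSubBlocks_mul_communicabilityBlocks {n M : ℕ} (a : ℝ)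
    (A : ℕ → Matrix (Fin n) (Fin n) ℝ)
    (hA : ∀ s, 1 ≤ s → s ≤ M → IsUnit (1 - a • A s)) :
    oneSubBlocks M a A * communicabilityBlocks M a A = 1 := by
  ext1 k l
  have hk : (1 - a • A (k + 1)) * (1 - a • A (k + 1))⁻¹ = 1 :=
    Matrix.mul_nonsing_inv _ ((Matrix.isUnit_iff_isUnit_det _).mp (hA _ (by omega) (by omega)))
  have hnext : ∑ m : Fin M, (if (k : ℕ) + 1 = m then communicabilityBlocks M a A m l else 0) =
      if k < l then resProd a A (k + 1 + 1) (l + 1) else 0 := by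
    by_cases hM : (k : ℕ) + 1 < M
    · rw [Finset.sum_eq_single ⟨k + 1, hM⟩]
      · have hiff : (⟨k + 1, hM⟩ : Fin M) ≤ l ↔ k < l := Nat.succ_le_iff
        simp only [communicabilityBlocks, hiff, if_true]
      · intro m _ hm
        rw [if_neg]
        exact fun h => hm (Fin.ext h.symm)
      · simp
    · rw [Finset.sum_eq_zero, if_neg]
      · rw [Fin.lt_def]; omega
      · intro m _
        rw [if_neg]
        omega
  simp only [Matrix.mul_apply, oneSubBlocks, sub_mul (ite _ _ _) (ite _ _ _),
    Finset.sum_sub_distrib, ite_mul, zero_mul, one_mul, Finset.sum_ite_eq, Finset.mem_univ,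
    if_true, hnext]
  rcases lt_trichotomy k l with h | h | h
  · have hle : (k : ℕ) + 1 ≤ l + 1 := by rw [Fin.lt_def] at h; omega
    rw [communicabilityBlocks, if_pos h.le, if_pos h, Matrix.one_apply_ne h.ne,
      resProd_eq_mul a A hle, ← mul_assoc, hk, one_mul, sub_self]
  · subst h
    simp only [communicabilityBlocks, le_refl, lt_irrefl, if_true, if_false, resProd_self, hk,
      sub_zero, Matrix.one_apply_eq]
  · simp [communicabilityBlocks, h.not_ge, h.not_gt, Matrix.one_apply_ne h.ne']

theorem one_sub_blockB_mul_comp_communicabilityBlocks {n M : ℕ} (a : ℝ)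
    (A : ℕ → Matrix (Fin n) (Fin n) ℝ)
    (hA : ∀ s, 1 ≤ s → s ≤ M → IsUnit (1 - a • A s)) :
    (1 - blockB M a (fun _ => 1) A) *
      Matrix.comp _ _ _ _ _ (communicabilityBlocks M a A) = 1 := by
  rw [← comp_oneSubBlocks]
  have h := congrArg (Matrix.compRingEquiv (Fin M) (Fin n) ℝ)
    (oneSubBlocks_mul_communicabilityBlocks a A hA)
  rwa [map_mul, map_one] at h

/-- With `α = a` and all superdiagonal weights `β_ℓ = 1`, the matrix
`I - B` is invertible and for all `1 ≤ i ≤ j ≤ M` the `(i,j)` block of `(I - B)⁻¹`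
equals the dynamic communicability matrix `Q^{[i,j]} = ∏_{s=i}^{j} (I - aA^[s])⁻¹`. -/
theorem block_resolvent_recovers_communicability {n M : ℕ}
    (A : ℕ → Matrix (Fin n) (Fin n) ℝ)
    (a : ℝ) (ha : 0 < a)
    (hρ : ∀ s, 1 ≤ s → s ≤ M → ENNReal.ofReal a * specRad (A s) < 1)
    (B : Matrix (Fin M × Fin n) (Fin M × Fin n) ℝ)
    (hB : B = blockB M a (fun _ => 1) A) :
    IsUnit (1 - B) ∧
    ∀ i j : ℕ, 1 ≤ i → i ≤ j → j ≤ M →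
      blockOf (1 - B)⁻¹ i j = resProd a A i j := by
  subst hB
  have hmul := one_sub_blockB_mul_comp_communicabilityBlocks a A
    fun s h1 hM => isUnit_one_sub_smul_of_specRad_lt (A s) ha (hρ s h1 hM)
  refine ⟨IsUnit.of_mul_eq_one _ hmul, fun i j hi hij hj => ?_⟩
  rw [Matrix.inv_eq_right_inv hmul]
  ext x y
  have hi' : i - 1 < M := by omega
  have hj' : j - 1 < M := by omega
  have hle : i - 1 ≤ j - 1 := by omega
  simp [blockOf, hi', hj', communicabilityBlocks, hle,
    Nat.sub_add_cancel hi, Nat.sub_add_cancel (hi.trans hij)]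
end

section
/- Vectorized receive communicability formula: under the same setup, for each j = 1,…,M the receive vector satisfies (S^[j])^T·1_n = (e_j ⊗ I_n)^T ((I_{Mn} − B)^{-1})^T (d ⊗ 1_n) − 1_n, where d ∈ ℝ^M has entries d_1 = 1, d_i = 1 − β_i for i ≥ 2, e_j ∈ ℝ^M is the j-th standard basis vector, 1_n ∈ ℝ^n is the all-ones vector, and ⊗ denotes the Kronecker product. -/
open Matrix BigOperators Finset

/-- A matrix whose spectral radius is less than `a⁻¹` has an invertible resolvent factor. -/
lemma isUnit_det_one_sub_smul {n : ℕ} (A : Matrix (Fin n) (Fin n) ℝ) {a : ℝ} (ha : 0 < a)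
    (h : ENNReal.ofReal a * specRad A < 1) : IsUnit (1 - a • A).det := by
  by_contra hdet
  have hz : (1 - a • A).det = 0 := by simpa using hdet
  have hmap : ((1 - a • A).map (algebraMap ℝ ℂ)).det = 0 := by
    have := RingHom.map_det (algebraMap ℝ ℂ) (1 - a • A)
    rw [hz, map_zero] at this
    exact this.symm
  have ha' : (a : ℂ) ≠ 0 := by exact_mod_cast ha.ne'
  have heq : (1 - a • A).map (algebraMap ℝ ℂ) =
      (a : ℂ) • (algebraMap ℂ (Matrix (Fin n) (Fin n) ℂ) (a : ℂ)⁻¹ -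
        A.map (algebraMap ℝ ℂ)) := by
    ext i j
    by_cases hij : i = j
    · subst hij
      simp [Matrix.algebraMap_matrix_apply, mul_sub, ha']
    · simp [Matrix.algebraMap_matrix_apply, hij]
  have hmem : (a : ℂ)⁻¹ ∈ spectrum ℂ (A.map (algebraMap ℝ ℂ)) := by
    rw [spectrum.mem_iff, Matrix.isUnit_iff_isUnit_det]
    rw [heq, Matrix.det_smul] at hmap
    have := (mul_eq_zero.mp hmap).resolve_left (pow_ne_zero _ ha')
    rw [this]
    exact not_isUnit_zero
  have hle : (‖(a : ℂ)⁻¹‖₊ : ENNReal) ≤ specRad A :=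
    le_iSup₂ (f := fun k (_ : k ∈ spectrum ℂ (A.map (algebraMap ℝ ℂ))) =>
      (‖k‖₊ : ENNReal)) _ hmem
  refine absurd h (not_lt.mpr ?_)
  have hone : ENNReal.ofReal a * (‖(a : ℂ)⁻¹‖₊ : ENNReal) = 1 := by
    have hn : (‖(a : ℂ)⁻¹‖₊ : ENNReal) = ENNReal.ofReal a⁻¹ := by
      rw [← enorm_eq_nnnorm, ← ofReal_norm]
      simp [abs_of_pos ha]
    rw [hn, ← ENNReal.ofReal_mul ha.le, mul_inv_cancel₀ ha.ne', ENNReal.ofReal_one]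
  calc 1 = ENNReal.ofReal a * (‖(a : ℂ)⁻¹‖₊ : ENNReal) := hone.symm
    _ ≤ _ := by gcongr

/-- Blockwise form of left multiplication of a block row vector by `1 - blockB M a β A`. -/
lemma vecMul_one_sub_blockB_apply {n M : ℕ} (a : ℝ) (β : ℕ → ℝ) (hβ1 : β 1 = 0)
    (A : ℕ → Matrix (Fin n) (Fin n) ℝ) (w : ℕ → Fin n → ℝ) (k : Fin M) (y : Fin n) :
    ((fun p : Fin M × Fin n => w (p.1.1 + 1) p.2) ᵥ* (1 - blockB M a β A)) (k, y) =
      (w (k.1 + 1) ᵥ* (1 - a • A (k.1 + 1))) y - β (k.1 + 1) * w k.1 y := by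
  have hsplit : ∀ p : Fin M × Fin n, w (p.1.1 + 1) p.2 * blockB M a β A p (k, y) =
      (if p.1 = k then w (k.1 + 1) p.2 * (a * A (k.1 + 1) p.2 y) else 0) +
      (if p.2 = y then (if p.1.1 + 1 = k.1 then β (k.1 + 1) * w k.1 y else 0) else 0) := by
    rintro ⟨i, x⟩
    simp only [blockB]
    by_cases hik : i = k
    · subst hik
      simp
    · by_cases hs : i.1 + 1 = k.1
      · by_cases hx : x = y
        · simp [hik, hs, hx, mul_comm]
        · simp [hik, hs, hx]
      · simp [hik, hs]
  have hprev : (∑ i : Fin M, if i.1 + 1 = k.1 then β (k.1 + 1) * w k.1 y else 0) =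
      β (k.1 + 1) * w k.1 y := by
    obtain ⟨k, hk⟩ := k
    cases k with
    | zero => simp [hβ1]
    | succ m =>
      rw [Finset.sum_eq_single (⟨m, by omega⟩ : Fin M)]
      · simp
      · intro i _ hi
        exact if_neg fun h => hi (Fin.ext (by simpa using h))
      · simp
  have hB : ((fun p : Fin M × Fin n => w (p.1.1 + 1) p.2) ᵥ* blockB M a β A) (k, y) =
      (w (k.1 + 1) ᵥ* (a • A (k.1 + 1))) y + β (k.1 + 1) * w k.1 y := by
    simp only [Matrix.vecMul, dotProduct, hsplit, Finset.sum_add_distrib,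
      Fintype.sum_prod_type, Matrix.smul_apply, smul_eq_mul]
    congr 1
    · rw [Finset.sum_comm]
      simp
    · simpa using hprev
  rw [Matrix.vecMul_sub, Matrix.vecMul_sub, Pi.sub_apply, Pi.sub_apply, hB]
  simp only [Matrix.vecMul_one]
  ring

/-- The block bidiagonal matrix `1 - blockB M a β A` is invertible as soon as its diagonal
blocks are. -/
lemma isUnit_det_one_sub_blockB {n M : ℕ} (a : ℝ) (β : ℕ → ℝ) (hβ1 : β 1 = 0)
    (A : ℕ → Matrix (Fin n) (Fin n) ℝ)
    (hA : ∀ s, 1 ≤ s → s ≤ M → IsUnit (1 - a • A s).det) :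
    IsUnit (1 - blockB M a β A).det := by
  rw [isUnit_iff_ne_zero]
  intro hdet
  obtain ⟨v, hv, hv0⟩ := Matrix.exists_vecMul_eq_zero_iff.mpr hdet
  obtain ⟨w, rfl, hw0⟩ : ∃ w : ℕ → Fin n → ℝ,
      v = (fun p : Fin M × Fin n => w (p.1.1 + 1) p.2) ∧ w 0 = 0 :=
    ⟨fun m y => if h : 1 ≤ m ∧ m - 1 < M then v (⟨m - 1, h.2⟩, y) else 0,
      by ext ⟨i, y⟩; simp, by ext; simp⟩
  have hw : ∀ k, k ≤ M → w k = 0 := by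
    intro k
    induction k with
    | zero => exact fun _ => hw0
    | succ k ih =>
      intro hk
      have hblock : w (k + 1) ᵥ* (1 - a • A (k + 1)) = 0 := by
        ext y
        have := vecMul_one_sub_blockB_apply a β hβ1 A w (⟨k, hk⟩ : Fin M) y
        rw [hv0] at this
        simpa [ih (by omega)] using this.symm
      by_contra hne
      exact (hA (k + 1) (by omega) hk).ne_zero
        (Matrix.exists_vecMul_eq_zero_iff.mp ⟨_, hne, hblock⟩)
  exact hv (funext fun p => by simp [hw (p.1.1 + 1) p.1.2])

/-- Vectorized receive communicability formula: with `d ∈ ℝ^M` given by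
`d_1 = 1`, `d_i = 1 - β_i` (`i ≥ 2`), `e_j` the `j`-th standard basis vector of `ℝ^M` and
`1_n` the all-ones vector, for each `j = 1,…,M`:
`(S^[j])ᵀ 1_n = (e_j ⊗ I_n)ᵀ ((I - B)⁻¹)ᵀ (d ⊗ 1_n) - 1_n`.
Here `e_j ⊗ I_n` is the `Mn × n` matrix whose `j`-th block is `I_n`, other blocks zero,
and `d ⊗ 1_n` is the `Mn`-vector whose `i`-th block is `d_i · 1_n`. -/
theorem receive_communicability_vectorized {n M : ℕ}
    (A : ℕ → Matrix (Fin n) (Fin n) ℝ)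
    (a b : ℝ) (ha : 0 < a) (hb : 0 < b)
    (hρ : ∀ s, 1 ≤ s → s ≤ M → ENNReal.ofReal a * specRad (A s) < 1)
    (Δt : ℕ → ℝ) (hΔt : ∀ ℓ, 2 ≤ ℓ → ℓ ≤ M → 0 < Δt ℓ)
    (β : ℕ → ℝ) (hβ1 : β 1 = 0)
    (hβ : ∀ ℓ, 2 ≤ ℓ → ℓ ≤ M → β ℓ = Real.exp (-(b * Δt ℓ)))
    (B : Matrix (Fin M × Fin n) (Fin M × Fin n) ℝ) (hB : B = blockB M a β A)
    (S : ℕ → Matrix (Fin n) (Fin n) ℝ) (hS0 : S 0 = 0)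
    (hS : ∀ j, 1 ≤ j → j ≤ M →
      S j = (1 + β j • S (j - 1)) * (1 - a • A j)⁻¹ - 1)
    (d : ℕ → ℝ) (hd1 : d 1 = 1) (hdi : ∀ i, 2 ≤ i → i ≤ M → d i = 1 - β i)
    (j : ℕ) (hj1 : 1 ≤ j) (hjM : j ≤ M) :
    (S j)ᵀ.mulVec (fun _ => 1) =
      ((show Matrix (Fin M × Fin n) (Fin n) ℝ from
          fun p y => (if p.1.1 + 1 = j then 1 else 0) * (if p.2 = y then 1 else 0))ᵀ *
        ((1 - B)⁻¹)ᵀ).mulVec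
          (fun p : Fin M × Fin n => d (p.1.1 + 1))
      - (fun _ => 1) := by
  have hA : ∀ s, 1 ≤ s → s ≤ M → IsUnit (1 - a • A s).det := fun s h1 h2 =>
    isUnit_det_one_sub_smul (A s) ha (hρ s h1 h2)
  have hd : ∀ i, 1 ≤ i → i ≤ M → d i = 1 - β i := by
    intro i h1 h2
    rcases h1.eq_or_lt with rfl | h
    · simp [hd1, hβ1]
    · exact hdi i h h2
  subst hB
  set w : ℕ → Fin n → ℝ := fun k => (fun _ => 1) ᵥ* (S k + 1) with hw
  have hsolve : (fun p : Fin M × Fin n => w (p.1.1 + 1) p.2) ᵥ* (1 - blockB M a β A) =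
      fun p => d (p.1.1 + 1) := by
    ext ⟨k, y⟩
    rw [vecMul_one_sub_blockB_apply a β hβ1 A w k y]
    have hrec : (S (k.1 + 1) + 1) * (1 - a • A (k.1 + 1)) = 1 + β (k.1 + 1) • S k.1 := by
      rw [hS (k.1 + 1) (by omega) k.2, sub_add_cancel,
        Matrix.nonsing_inv_mul_cancel_right _ _ (hA _ (by omega) k.2), Nat.add_sub_cancel]
    simp only [hw]
    rw [Matrix.vecMul_vecMul, hrec, hd _ (by omega) k.2]
    simp only [Matrix.vecMul_add, Matrix.vecMul_smul, Matrix.vecMul_one, Pi.add_apply,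
      Pi.smul_apply, smul_eq_mul]
    ring
  have hx : (fun p : Fin M × Fin n => d (p.1.1 + 1)) ᵥ* (1 - blockB M a β A)⁻¹ =
      fun p => w (p.1.1 + 1) p.2 := by
    rw [← hsolve, Matrix.vecMul_vecMul,
      Matrix.mul_nonsing_inv _ (isUnit_det_one_sub_blockB a β hβ1 A hA), Matrix.vecMul_one]
  obtain ⟨m, rfl⟩ : ∃ m, j = m + 1 := ⟨j - 1, by omega⟩
  rw [← Matrix.mulVec_mulVec, Matrix.mulVec_transpose, Matrix.mulVec_transpose,
    Matrix.mulVec_transpose, hx]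
  ext y
  have hsel : ((fun p : Fin M × Fin n => w (p.1.1 + 1) p.2) ᵥ*
      (show Matrix (Fin M × Fin n) (Fin n) ℝ from
        fun p y => (if p.1.1 + 1 = m + 1 then 1 else 0) * (if p.2 = y then 1 else 0))) y =
      w (m + 1) y := by
    simp only [Matrix.vecMul, dotProduct]
    rw [Finset.sum_eq_single ((⟨m, hjM⟩ : Fin M), y)]
    · simp
    · rintro ⟨i, x⟩ _ hne
      by_cases hi : i.1 = m
      · have hxy : x ≠ y := fun h => hne (Prod.ext (Fin.ext hi) h)
        simp [hxy]
      · simp [hi]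
    · simp
  rw [Pi.sub_apply, hsel]
  simp [hw, Matrix.vecMul_add]
end
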